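/- arXiv:2501.09144 — 3 statements merged into one kernel-verified Lean document; each statement's English description precedes it below -/
import Mathlib

section
/- Let V and E be finite types, src, tgt : E → V, and w : E → ℤ an integer edge-weight function. Fix a source node s and suppose no negative-weight cycle is reachable from s. If a node t is reachable from s, then there exists a walk P from s to t of length at most |V| − 1 such that the weight of P is less than or equal to the weight of every walk from s to t. -/
namespace BFPaper

variable {V E : Type*}

/-- `IsWalk src tgt u v es` : the list of edges `es` forms a walk from `u` to `v`
in the directed multigraph given by source and target maps `src tgt : E → V`. -/
inductive IsWalk (src tgt : E → V) : V → V → List E → Prop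
  | nil (u : V) : IsWalk src tgt u u []
  | cons {v : V} (e : E) {es : List E} (h : IsWalk src tgt (tgt e) v es) :
      IsWalk src tgt (src e) v (e :: es)

/-- The weight of a walk: the sum of the weights of its edges. -/
def weight (w : E → ℤ) (es : List E) : ℤ := (es.map w).sum

/-- `v` is reachable from `s` if there is a walk from `s` to `v`. -/
def Reachable (src tgt : E → V) (s v : V) : Prop :=
  ∃ es : List E, IsWalk src tgt s v es

/-- There is a negative-weight cycle reachable from `s`. -/
def HasNegCycleFrom (src tgt : E → V) (w : E → ℤ) (s : V) : Prop :=
  ∃ (u : V) (es : List E), es ≠ [] ∧ IsWalk src tgt u u es ∧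
    weight w es < 0 ∧ Reachable src tgt s u

/-- The Bellman-Ford distance function `d : ℕ → V → WithTop ℤ`. -/
def bfDist [Fintype E] [DecidableEq V] (src tgt : E → V) (w : E → ℤ) (s : V) :
    ℕ → V → WithTop ℤ
  | 0 => fun v => if v = s then (0 : WithTop ℤ) else ⊤
  | (k+1) => fun v =>
      min (bfDist src tgt w s k v)
        (Finset.univ.inf fun e : E =>
          if tgt e = v then bfDist src tgt w s k (src e) + (w e : WithTop ℤ) else ⊤)

end BFPaper

namespace BFPaper

variable {V E : Type*} {src tgt : E → V} {w : E → ℤ}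

theorem weight_append (as bs : List E) :
    weight w (as ++ bs) = weight w as + weight w bs := by
  simp [weight]

theorem IsWalk.append {u v x : V} {as bs : List E} (ha : IsWalk src tgt u v as)
    (hb : IsWalk src tgt v x bs) : IsWalk src tgt u x (as ++ bs) := by
  induction ha with
  | nil => exact hb
  | cons e _ ih => exact .cons e (ih hb)

theorem IsWalk.exists_split {u v : V} {as bs : List E}
    (h : IsWalk src tgt u v (as ++ bs)) :
    ∃ x, IsWalk src tgt u x as ∧ IsWalk src tgt x v bs := by
  induction as generalizing u with
  | nil => exact ⟨u, .nil u, h⟩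
  | cons e as ih =>
    cases h with
    | cons _ h =>
      obtain ⟨x, hx, hb⟩ := ih h
      exact ⟨x, .cons e hx, hb⟩

theorem IsWalk.target_unique {u v x : V} {es : List E} (h : IsWalk src tgt u v es)
    (h' : IsWalk src tgt u x es) : v = x := by
  induction h with
  | nil => cases h'; rfl
  | cons e _ ih =>
    generalize hu : src e = u at h'
    cases h' with
    | cons _ h' => exact ih h'

/-- A walk with at least `|V|` edges contains a nonempty cycle. -/
theorem IsWalk.exists_cycle [Fintype V] {u v : V} {es : List E}
    (h : IsWalk src tgt u v es) (hlen : Fintype.card V ≤ es.length) :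
    ∃ (x : V) (as bs cs : List E), es = as ++ (bs ++ cs) ∧ bs ≠ [] ∧
      IsWalk src tgt u x as ∧ IsWalk src tgt x x bs ∧ IsWalk src tgt x v cs := by
  have hsplit (i : Fin (es.length + 1)) :
      ∃ x, IsWalk src tgt u x (es.take i) ∧ IsWalk src tgt x v (es.drop i) :=
    IsWalk.exists_split (by rwa [List.take_append_drop])
  choose f hpre hsuf using hsplit
  obtain ⟨i, j, hij, hf⟩ : ∃ i j, i < j ∧ f i = f j := by
    obtain ⟨i, j, hne, hf⟩ := Fintype.exists_ne_map_eq_of_card_lt f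
      (by rw [Fintype.card_fin]; omega)
    rcases lt_or_gt_of_ne hne with hlt | hlt
    · exact ⟨i, j, hlt, hf⟩
    · exact ⟨j, i, hlt, hf.symm⟩
  have hij' : (i : ℕ) < j := hij
  have hj : es.take j = es.take i ++ (es.drop i).take (j - i) := by
    rw [← List.take_add, Nat.add_sub_cancel' hij'.le]
  have hd : (es.drop i).drop (j - i) = es.drop j := by
    rw [List.drop_drop, Nat.add_sub_cancel' hij'.le]
  refine ⟨f i, es.take i, (es.drop i).take (j - i), es.drop j, ?_, ?_, hpre i, ?_, ?_⟩
  · rw [← hd, List.take_append_drop, List.take_append_drop]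
  · intro hnil
    have := congrArg List.length hnil
    simp only [List.length_take, List.length_drop, List.length_nil] at this
    have := j.isLt
    omega
  · have hw := hpre j
    rw [hj] at hw
    obtain ⟨y, hy, hmid⟩ := hw.exists_split
    rwa [hy.target_unique (hpre i), ← hf] at hmid
  · rw [hf]; exact hsuf j

/-- Without reachable negative cycles, every walk from the source can be replaced by one
with fewer than `|V|` edges that is no heavier. -/
theorem IsWalk.exists_short_weight_le [Fintype V] {s t : V}
    (hnc : ¬ HasNegCycleFrom src tgt w s) {Q : List E} (hQ : IsWalk src tgt s t Q) :
    ∃ P, IsWalk src tgt s t P ∧ P.length < Fintype.card V ∧ weight w P ≤ weight w Q := by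
  induction hn : Q.length using Nat.strong_induction_on generalizing Q with
  | _ n ih =>
    subst hn
    by_cases hlen : Q.length < Fintype.card V
    · exact ⟨Q, hQ, hlen, le_rfl⟩
    obtain ⟨x, as, bs, cs, rfl, hbs, ha, hb, hc⟩ := hQ.exists_cycle (not_lt.mp hlen)
    have hpos : 0 ≤ weight w bs := by
      by_contra hneg
      exact hnc ⟨x, bs, hbs, hb, not_le.mp hneg, as, ha⟩
    have hblen := List.length_pos_iff.mpr hbs
    obtain ⟨P, hP, hPlen, hPw⟩ := ih (as ++ cs).length
      (by simp only [List.length_append]; omega) (ha.append hc) rfl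
    refine ⟨P, hP, hPlen, hPw.trans ?_⟩
    simp only [weight_append]
    omega

end BFPaper

/-- If no negative-weight cycle is reachable from `s` and `t` is reachable from `s`,
then there is a walk from `s` to `t` of length at most `|V| - 1` whose weight is
minimal among all walks from `s` to `t`. -/
theorem exists_short_min_weight_walk
    (V E : Type*) [Fintype V] [Fintype E] (src tgt : E → V) (w : E → ℤ) (s t : V)
    (hnc : ¬ BFPaper.HasNegCycleFrom src tgt w s)
    (hreach : BFPaper.Reachable src tgt s t) :
    ∃ P : List E, BFPaper.IsWalk src tgt s t P ∧ P.length ≤ Fintype.card V - 1 ∧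
      ∀ Q : List E, BFPaper.IsWalk src tgt s t Q →
        BFPaper.weight w P ≤ BFPaper.weight w Q := by
  have hfin : {P : List E | BFPaper.IsWalk src tgt s t P ∧ P.length < Fintype.card V}.Finite :=
    (List.finite_length_lt E (Fintype.card V)).subset fun _ hP => hP.2
  obtain ⟨Q₀, hQ₀⟩ := hreach
  obtain ⟨P₀, hP₀, hlen₀, -⟩ := hQ₀.exists_short_weight_le hnc
  obtain ⟨P, ⟨hP, hlen⟩, hmin⟩ :=
    Set.exists_min_image _ (BFPaper.weight w) hfin ⟨P₀, hP₀, hlen₀⟩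
  refine ⟨P, hP, Nat.le_sub_one_of_lt hlen, fun Q hQ => ?_⟩
  obtain ⟨R, hR, hRlen, hRw⟩ := hQ.exists_short_weight_le hnc
  exact (hmin R ⟨hR, hRlen⟩).trans hRw
end

section
/- Let V and E be finite types, src, tgt : E → V, w : E → ℤ, and fix a source node s. Let d : ℕ → V → WithTop ℤ be the Bellman-Ford distance function. Then for every k ∈ ℕ and every node v, d k v equals the minimum, taken in WithTop ℤ, of the weights of all walks from s to v of length at most k (equal to ⊤ if no such walk exists); in particular, d k v is a lower bound on the weight of every walk from s to v of length at most k, and if some walk from s to v of length at most k exists, then some such walk has weight equal to d k v. -/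
namespace BFPaper

section

variable {V E : Type*} {src tgt : E → V}

theorem IsWalk.concat {u v : V} {P : List E} (h : IsWalk src tgt u v P) (e : E)
    (he : src e = v) : IsWalk src tgt u (tgt e) (P ++ [e]) := by
  induction h with
  | nil u => subst he; exact .cons e (.nil _)
  | cons f _ ih => exact .cons f (ih he)

theorem weight_cons (w : E → ℤ) (e : E) (P : List E) :
    weight w (e :: P) = w e + weight w P := by
  simp [weight]

theorem weight_concat (w : E → ℤ) (P : List E) (e : E) :
    weight w (P ++ [e]) = weight w P + w e := by
  simp [weight]

variable [Fintype E] [DecidableEq V] (w : E → ℤ) (s : V)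

theorem bfDist_antitone (v : V) : Antitone fun k => bfDist src tgt w s k v :=
  antitone_nat_of_succ_le fun _ => min_le_left _ _

theorem bfDist_succ_tgt_le (k : ℕ) (e : E) :
    bfDist src tgt w s (k + 1) (tgt e) ≤ bfDist src tgt w s k (src e) + (w e : WithTop ℤ) :=
  (min_le_right _ _).trans <| (Finset.inf_le (Finset.mem_univ e)).trans <| by simp

/-- Following a walk from `u` to `v` relaxes the distance of `v` against that of `u`. -/
theorem IsWalk.bfDist_add_length_le {u v : V} {P : List E} (h : IsWalk src tgt u v P) (k : ℕ) :
    bfDist src tgt w s (k + P.length) v ≤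
      bfDist src tgt w s k u + (weight w P : WithTop ℤ) := by
  induction h generalizing k with
  | nil u => simp [weight]
  | @cons v e P _ ih =>
    calc bfDist src tgt w s (k + (e :: P).length) v
        = bfDist src tgt w s (k + 1 + P.length) v := by
          rw [List.length_cons, add_assoc, add_comm 1]
      _ ≤ bfDist src tgt w s (k + 1) (tgt e) + (weight w P : WithTop ℤ) := ih (k + 1)
      _ ≤ bfDist src tgt w s k (src e) + (w e : WithTop ℤ) + (weight w P : WithTop ℤ) := by
          gcongr
          exact bfDist_succ_tgt_le w s k e
      _ = bfDist src tgt w s k (src e) + (weight w (e :: P) : WithTop ℤ) := by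
          rw [weight_cons, WithTop.coe_add, add_assoc]

theorem IsWalk.bfDist_le_weight {v : V} {P : List E} (h : IsWalk src tgt s v P) {k : ℕ}
    (hk : P.length ≤ k) : bfDist src tgt w s k v ≤ (weight w P : WithTop ℤ) := by
  have h0 := h.bfDist_add_length_le w s 0
  rw [zero_add] at h0
  exact (bfDist_antitone w s v hk).trans (by simpa [bfDist] using h0)

/-- Every finite Bellman-Ford distance is the weight of a short walk. -/
theorem exists_isWalk_weight_eq_bfDist (k : ℕ) {v : V} (hv : bfDist src tgt w s k v ≠ ⊤) :
    ∃ P : List E, IsWalk src tgt s v P ∧ P.length ≤ k ∧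
      (weight w P : WithTop ℤ) = bfDist src tgt w s k v := by
  induction k generalizing v with
  | zero =>
    obtain rfl : v = s := by
      by_contra h
      exact hv (by simp [bfDist, h])
    exact ⟨[], .nil _, le_rfl, by simp [bfDist, weight]⟩
  | succ k ih =>
    have hmin : bfDist src tgt w s (k + 1) v = min (bfDist src tgt w s k v)
        (Finset.univ.inf fun e : E =>
          if tgt e = v then bfDist src tgt w s k (src e) + (w e : WithTop ℤ) else ⊤) := rfl
    rcases min_choice (bfDist src tgt w s k v) (Finset.univ.inf fun e : E =>
      if tgt e = v then bfDist src tgt w s k (src e) + (w e : WithTop ℤ) else ⊤) with h | h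
    · rw [hmin, h] at hv ⊢
      obtain ⟨P, hP, hlen, hw⟩ := ih hv
      exact ⟨P, hP, hlen.trans k.le_succ, hw⟩
    · rw [hmin, h] at hv ⊢
      have hne : (Finset.univ : Finset E).Nonempty := by
        rw [Finset.nonempty_iff_ne_empty]
        intro h0
        simp [h0] at hv
      obtain ⟨e, -, he⟩ := Finset.exists_mem_eq_inf Finset.univ hne fun e : E =>
        if tgt e = v then bfDist src tgt w s k (src e) + (w e : WithTop ℤ) else ⊤
      rw [he] at hv ⊢
      obtain rfl : tgt e = v := by
        by_contra h
        exact hv (if_neg h)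
      rw [if_pos rfl] at hv ⊢
      obtain ⟨P, hP, hlen, hw⟩ := ih (WithTop.add_ne_top.1 hv).1
      exact ⟨P ++ [e], hP.concat e rfl, by simpa using hlen,
        by rw [weight_concat, WithTop.coe_add, hw]⟩

end

end BFPaper

/-- The Bellman-Ford distance `d k v` is the minimum weight of walks from `s` to `v`
of length at most `k` (and `⊤` if no such walk exists). -/
theorem bfDist_eq_min_weight_of_short_walks
    (V E : Type*) [Fintype V] [Fintype E] [DecidableEq V]
    (src tgt : E → V) (w : E → ℤ) (s : V) (k : ℕ) (v : V) :
    (∀ P : List E, BFPaper.IsWalk src tgt s v P → P.length ≤ k →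
        BFPaper.bfDist src tgt w s k v ≤ (BFPaper.weight w P : WithTop ℤ)) ∧
    ((∃ P : List E, BFPaper.IsWalk src tgt s v P ∧ P.length ≤ k) →
        ∃ P : List E, BFPaper.IsWalk src tgt s v P ∧ P.length ≤ k ∧
          (BFPaper.weight w P : WithTop ℤ) = BFPaper.bfDist src tgt w s k v) ∧
    ((¬ ∃ P : List E, BFPaper.IsWalk src tgt s v P ∧ P.length ≤ k) →
        BFPaper.bfDist src tgt w s k v = ⊤) := by
  refine ⟨fun P hP hk => hP.bfDist_le_weight w s hk, ?_, ?_⟩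
  · rintro ⟨P, hP, hk⟩
    exact BFPaper.exists_isWalk_weight_eq_bfDist w s k
      ((hP.bfDist_le_weight w s hk).trans_lt (WithTop.coe_lt_top _)).ne
  · intro h
    by_contra hv
    obtain ⟨P, hP, hk, -⟩ := BFPaper.exists_isWalk_weight_eq_bfDist w s k hv
    exact h ⟨P, hP, hk⟩
end

section
/- Let V and E be finite types, src, tgt : E → V, w : E → ℤ, and fix a source node s. Let d : ℕ → V → WithTop ℤ be the Bellman-Ford distance function. Then for every k ∈ ℕ and every node v, d k v ≠ ⊤ if and only if there exists a walk from s to v of length at most k. -/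
namespace BFPaper

theorem IsWalk.append_edge {V E : Type*} {src tgt : E → V} {u v : V} {P : List E}
    (h : IsWalk src tgt u v P) (e : E) (he : src e = v) :
    IsWalk src tgt u (tgt e) (P ++ [e]) := by
  induction h with
  | nil u => subst he; exact .cons e (.nil _)
  | cons e' _ ih => exact .cons e' (ih he)

theorem IsWalk.eq_nil_or_append_edge {V E : Type*} {src tgt : E → V} {u v : V} {P : List E}
    (h : IsWalk src tgt u v P) :
    (P = [] ∧ u = v) ∨
      ∃ (Q : List E) (e : E), P = Q ++ [e] ∧ IsWalk src tgt u (src e) Q ∧ tgt e = v := by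
  induction h with
  | nil u => exact .inl ⟨rfl, rfl⟩
  | cons e _ ih =>
    right
    rcases ih with ⟨rfl, rfl⟩ | ⟨Q, e', rfl, hQ, rfl⟩
    · exact ⟨[], e, rfl, .nil _, rfl⟩
    · exact ⟨e :: Q, e', rfl, .cons e hQ, rfl⟩

theorem bfDist_succ_ne_top_iff {V E : Type*} [Fintype E] [DecidableEq V]
    (src tgt : E → V) (w : E → ℤ) (s : V) (k : ℕ) (v : V) :
    bfDist src tgt w s (k + 1) v ≠ ⊤ ↔
      bfDist src tgt w s k v ≠ ⊤ ∨ ∃ e, tgt e = v ∧ bfDist src tgt w s k (src e) ≠ ⊤ := by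
  simp only [bfDist, ne_eq, min_eq_top, Finset.inf_eq_top_iff, Finset.mem_univ, true_implies,
    ite_eq_right_iff, WithTop.add_eq_top, WithTop.coe_ne_top, or_false, not_and_or, not_forall,
    exists_prop]

end BFPaper

/-- The Bellman-Ford distance `d k v` is finite iff there is a walk from `s` to `v`
of length at most `k`. -/
theorem bfDist_ne_top_iff_exists_short_walk
    (V E : Type*) [Fintype V] [Fintype E] [DecidableEq V]
    (src tgt : E → V) (w : E → ℤ) (s : V) (k : ℕ) (v : V) :
    BFPaper.bfDist src tgt w s k v ≠ ⊤ ↔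
      ∃ P : List E, BFPaper.IsWalk src tgt s v P ∧ P.length ≤ k := by
  induction k generalizing v with
  | zero =>
    constructor
    · intro h
      have hv : v = s := by
        by_contra hv
        exact h (if_neg hv)
      subst hv
      exact ⟨[], .nil _, le_rfl⟩
    · rintro ⟨P, hP, hlen⟩
      obtain rfl := List.length_eq_zero_iff.mp (Nat.le_zero.mp hlen)
      cases hP
      simp [BFPaper.bfDist]
  | succ k ih =>
    simp only [BFPaper.bfDist_succ_ne_top_iff, ih]
    constructor
    · rintro (⟨P, hP, hlen⟩ | ⟨e, rfl, P, hP, hlen⟩)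
      · exact ⟨P, hP, by lia⟩
      · exact ⟨P ++ [e], hP.append_edge e rfl, by simpa using hlen⟩
    · rintro ⟨P, hP, hlen⟩
      rcases hP.eq_nil_or_append_edge with ⟨rfl, rfl⟩ | ⟨Q, e, rfl, hQ, rfl⟩
      · exact .inl ⟨[], hP, by simp⟩
      · exact .inr ⟨e, rfl, Q, hQ, by simpa using hlen⟩
end
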